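/- Let k be an algebraically closed field of characteristic 2. For x, y ∈ k let N(x,y) denote the 3×3 matrix [[0,0,0],[x,0,y],[0,0,0]], and let 𝒩 = { N(x,y) : x, y ∈ k }. Let 𝒰 be the set of 3×3 matrices M = [[x₁, 0, x₂], [x₃, 1, x₄], [x₅, 0, x₁]] over k satisfying x₁x₅ + x₃² = 0, x₁x₂ + x₄² = 0, and x₁² + x₂x₅ + 1 = 0. For a 2×2 matrix g = [[a,b],[c,d]] with det g = 1, let A(g) = [[a², 0, b²], [ac, 1, bd], [c², 0, d²]]; both 𝒩 and 𝒰 are stable under M ↦ A(g)·M·A(g)⁻¹. Then there is no bijection Φ : 𝒩 → 𝒰 such that (i) each matrix entry of Φ(N) is given by evaluating a fixed polynomial over k in the 9 entries of N, (ii) each matrix entry of Φ⁻¹(M) is given by evaluating a fixed polynomial over k in the 9 entries of M, and (iii) Φ(A(g)·N·A(g)⁻¹) = A(g)·Φ(N)·A(g)⁻¹ for every N ∈ 𝒩 and every 2×2 matrix g with det g = 1. -/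

import Mathlib

open MvPolynomial

/-- The nilpotent cone `𝒩(𝔭𝔤𝔩₂)`: matrices `N(x,y) = [[0,0,0],[x,0,y],[0,0,0]]`. -/
def nilCone (k : Type*) [Field k] : Set (Matrix (Fin 3) (Fin 3) k) :=
  {N | ∃ x y : k, N = !![0, 0, 0; x, 0, y; 0, 0, 0]}

/-- The unipotent variety `𝒰(PGL₂)` in characteristic `2`: matrices
`[[x₁,0,x₂],[x₃,1,x₄],[x₅,0,x₁]]` with `x₁x₅ + x₃² = 0`, `x₁x₂ + x₄² = 0`,
`x₁² + x₂x₅ + 1 = 0`. -/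
def unipVar (k : Type*) [Field k] : Set (Matrix (Fin 3) (Fin 3) k) :=
  {M | ∃ x₁ x₂ x₃ x₄ x₅ : k,
    M = !![x₁, 0, x₂; x₃, 1, x₄; x₅, 0, x₁] ∧
      x₁ * x₅ + x₃ ^ 2 = 0 ∧ x₁ * x₂ + x₄ ^ 2 = 0 ∧ x₁ ^ 2 + x₂ * x₅ + 1 = 0}

/-- The image `A(g) = Ad(g)` of `g ∈ SL₂` in `PGL₂ ⊆ GL₃`, in characteristic `2`. -/
def AdMat {k : Type*} [Field k] (g : Matrix (Fin 2) (Fin 2) k) :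
    Matrix (Fin 3) (Fin 3) k :=
  !![(g 0 0) ^ 2, 0, (g 0 1) ^ 2;
     g 0 0 * g 1 0, 1, g 0 1 * g 1 1;
     (g 1 0) ^ 2, 0, (g 1 1) ^ 2]

/-- A map between subsets of `3×3` matrix space is polynomial on a set `s` if each
entry of its value is given by evaluating a fixed polynomial in the 9 entries of
the input, for all inputs in `s`. -/
def IsPolynomialOn {k : Type*} [Field k] (s : Set (Matrix (Fin 3) (Fin 3) k))
    (Φ : Matrix (Fin 3) (Fin 3) k → Matrix (Fin 3) (Fin 3) k) : Prop :=
  ∃ P : Fin 3 → Fin 3 → MvPolynomial (Fin 3 × Fin 3) k,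
    ∀ N ∈ s, ∀ i j : Fin 3, Φ N i j = eval (fun q => N q.1 q.2) (P i j)

/-- The matrix `N(x, y)` with row `(x, 0, y)` in the middle and zeros elsewhere. -/
def nilMat {R : Type*} [Zero R] (x y : R) : Matrix (Fin 3) (Fin 3) R :=
  !![0, 0, 0; x, 0, y; 0, 0, 0]

theorem nilMat_mem_nilCone {k : Type*} [Field k] (x y : k) : nilMat x y ∈ nilCone k :=
  ⟨x, y, rfl⟩

theorem AdMat_upper {k : Type*} [Field k] (b : k) :
    AdMat !![1, b; 0, 1] = !![1, 0, b ^ 2; 0, 1, b; 0, 0, 1] := by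
  simp [AdMat]

theorem AdMat_lower {k : Type*} [Field k] (c : k) :
    AdMat !![1, 0; c, 1] = !![1, 0, 0; c, 1, 0; c ^ 2, 0, 1] := by
  simp [AdMat]

theorem AdMat_upper_inv {k : Type*} [Field k] [CharP k 2] (b : k) :
    (AdMat !![1, b; 0, 1])⁻¹ = !![1, 0, b ^ 2; 0, 1, b; 0, 0, 1] := by
  apply Matrix.inv_eq_right_inv
  rw [AdMat_upper]
  ext i j
  fin_cases i <;> fin_cases j <;>
    simp [Matrix.mul_apply, Fin.sum_univ_three, CharTwo.add_self_eq_zero]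

theorem AdMat_lower_inv {k : Type*} [Field k] [CharP k 2] (c : k) :
    (AdMat !![1, 0; c, 1])⁻¹ = !![1, 0, 0; c, 1, 0; c ^ 2, 0, 1] := by
  apply Matrix.inv_eq_right_inv
  rw [AdMat_lower]
  ext i j
  fin_cases i <;> fin_cases j <;>
    simp [Matrix.mul_apply, Fin.sum_univ_three, CharTwo.add_self_eq_zero]

theorem AdMat_upper_conj_nilMat {k : Type*} [Field k] [CharP k 2] (b : k) :
    AdMat !![1, b; 0, 1] * nilMat 0 1 * (AdMat !![1, b; 0, 1])⁻¹ = nilMat 0 1 := by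
  rw [AdMat_upper_inv, AdMat_upper]
  ext i j
  fin_cases i <;> fin_cases j <;> simp [nilMat, Matrix.mul_apply, Fin.sum_univ_three]

theorem AdMat_lower_conj_nilMat {k : Type*} [Field k] [CharP k 2] (c : k) :
    AdMat !![1, 0; c, 1] * nilMat 0 1 * (AdMat !![1, 0; c, 1])⁻¹ = nilMat (c ^ 2) 1 := by
  rw [AdMat_lower_inv, AdMat_lower]
  ext i j
  fin_cases i <;> fin_cases j <;> simp [nilMat, Matrix.mul_apply, Fin.sum_univ_three]

/-- An element of the unipotent variety fixed by conjugation by `Ad [[1, 1], [0, 1]]` is itself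
of the form `Ad [[1, s], [0, 1]]`. -/
theorem exists_eq_AdMat_upper {k : Type*} [Field k] [CharP k 2] {M : Matrix (Fin 3) (Fin 3) k}
    (hM : M ∈ unipVar k)
    (hfix : AdMat !![1, 1; 0, 1] * M * (AdMat !![1, 1; 0, 1])⁻¹ = M) :
    ∃ s : k, M = AdMat !![1, s; 0, 1] := by
  obtain ⟨x₁, x₂, x₃, x₄, x₅, rfl, h₁, h₂, h₃⟩ := hM
  rw [AdMat_upper_inv, AdMat_upper] at hfix
  have h₅ : x₅ = 0 := by
    simpa [Matrix.mul_apply, Fin.sum_univ_three] using congrFun (congrFun hfix 0) 0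
  subst h₅
  obtain rfl : x₃ = 0 := by simpa using h₁
  have hx : x₁ = 1 := by
    have h : x₁ ^ 2 = 1 ^ 2 := by
      simpa [CharTwo.add_eq_zero] using h₃
    exact CharTwo.sq_injective h
  subst hx
  have hx₂ : x₂ = x₄ ^ 2 := by simpa [CharTwo.add_eq_zero] using h₂
  exact ⟨x₄, by rw [AdMat_upper, hx₂]⟩

theorem AdMat_lower_conj_AdMat_upper_apply {k : Type*} [Field k] [CharP k 2] (c s : k) :
    (AdMat !![1, 0; c, 1] * AdMat !![1, s; 0, 1] * (AdMat !![1, 0; c, 1])⁻¹) 1 0 =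
      s ^ 2 * c ^ 3 + s * c ^ 2 := by
  rw [AdMat_lower_inv, AdMat_lower, AdMat_upper]
  simp only [Matrix.mul_apply, Fin.sum_univ_three]
  simp
  linear_combination c * CharTwo.two_eq_zero (R := k)

/-- Over an infinite field, a polynomial in `c ^ 2` has no `c ^ 3` term. -/
theorem eq_zero_of_eval_sq {k : Type*} [Field k] [Infinite k] {p : Polynomial k} {a b : k}
    (h : ∀ c : k, p.eval (c ^ 2) = a * c ^ 3 + b * c ^ 2) : a = 0 := by
  have hp : Polynomial.expand k 2 p =
      Polynomial.C a * Polynomial.X ^ 3 + Polynomial.C b * Polynomial.X ^ 2 :=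
    Polynomial.funext fun c => by simp [Polynomial.expand_eval, h]
  have h3 := congrArg (Polynomial.coeff · 3) hp
  simpa [Polynomial.coeff_expand, Polynomial.coeff_X_pow] using h3.symm

/-- A polynomial in the matrix entries restricts to a one-variable polynomial on `x ↦ N(x, y)`. -/
theorem exists_polynomial_eval_nilMat {k : Type*} [Field k]
    (P : MvPolynomial (Fin 3 × Fin 3) k) (y : k) :
    ∃ p : Polynomial k, ∀ x : k, p.eval x = eval (fun q => nilMat x y q.1 q.2) P := by
  refine ⟨aeval (fun q => nilMat Polynomial.X (Polynomial.C y) q.1 q.2) P, fun x => ?_⟩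
  rw [← Polynomial.coe_evalRingHom, MvPolynomial.map_aeval, coe_eval₂Hom, ← eval₂_id]
  congr 1
  · ext; simp
  · funext ⟨i, j⟩
    fin_cases i <;> fin_cases j <;> simp [nilMat]

/-- Over an algebraically closed field `k` of characteristic `2`, there
is no `PGL₂`-equivariant bijection `Φ : 𝒩(𝔭𝔤𝔩₂) → 𝒰(PGL₂)` such that both `Φ` and
`Φ⁻¹` are given by polynomials in the matrix entries: i.e. no Springer isomorphism
exists for `PGL₂` in characteristic `2`. -/
theorem stmt_16 {k : Type*} [Field k] [IsAlgClosed k] [CharP k 2] :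
    ¬ ∃ Φ Ψ : Matrix (Fin 3) (Fin 3) k → Matrix (Fin 3) (Fin 3) k,
      (∀ N ∈ nilCone k, Φ N ∈ unipVar k) ∧
      (∀ M ∈ unipVar k, Ψ M ∈ nilCone k) ∧
      (∀ N ∈ nilCone k, Ψ (Φ N) = N) ∧
      (∀ M ∈ unipVar k, Φ (Ψ M) = M) ∧
      IsPolynomialOn (nilCone k) Φ ∧
      IsPolynomialOn (unipVar k) Ψ ∧
      (∀ N ∈ nilCone k, ∀ g : Matrix (Fin 2) (Fin 2) k, g.det = 1 →
        Φ (AdMat g * N * (AdMat g)⁻¹) = AdMat g * Φ N * (AdMat g)⁻¹) := by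
  rintro ⟨Φ, Ψ, hΦ, -, hΨΦ, -, ⟨P, hP⟩, -, hequiv⟩
  have hN := nilMat_mem_nilCone (0 : k) 1
  obtain ⟨s, hs⟩ := exists_eq_AdMat_upper (hΦ _ hN) (by
    rw [← hequiv _ hN _ (by simp), AdMat_upper_conj_nilMat])
  have hlower (c : k) : Φ (nilMat (c ^ 2) 1) =
      AdMat !![1, 0; c, 1] * AdMat !![1, s; 0, 1] * (AdMat !![1, 0; c, 1])⁻¹ := by
    rw [← hs, ← hequiv _ hN _ (by simp), AdMat_lower_conj_nilMat]
  obtain ⟨p, hp⟩ := exists_polynomial_eval_nilMat (P 1 0) 1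
  have : Infinite k := IsAlgClosed.instInfinite
  have hs0 : s = 0 := by
    refine pow_eq_zero_iff two_ne_zero |>.1 (eq_zero_of_eval_sq (p := p) (b := s) fun c => ?_)
    rw [hp, ← hP _ (nilMat_mem_nilCone _ _), hlower, AdMat_lower_conj_AdMat_upper_apply]
  subst hs0
  have hone : AdMat !![1, 0; 0, 1] = (1 : Matrix (Fin 3) (Fin 3) k) := by
    rw [AdMat_upper]
    simp [Matrix.one_fin_three]
  have hconst : Φ (nilMat 1 1) = Φ (nilMat 0 1) := by
    have h := hlower 1
    have hinv : AdMat !![1, 0; 1, 1] * (AdMat !![1, 0; 1, 1])⁻¹ =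
        (1 : Matrix (Fin 3) (Fin 3) k) :=
      Matrix.mul_nonsing_inv _ (by simp [AdMat_lower, Matrix.det_fin_three])
    rwa [one_pow, hone, mul_one, hinv, ← hone, ← hs] at h
  have heq := congrArg Ψ hconst
  rw [hΨΦ _ (nilMat_mem_nilCone _ _), hΨΦ _ hN] at heq
  simpa [nilMat] using congrFun (congrFun heq 1) 0
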